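/- Let m be a bounded C² function on (0,1) such that (ξ(1−ξ))^k |m^{(k)}(ξ)| ≤ c for all ξ ∈ (0,1) and k = 0, 1, 2, for some constant c > 0. Then the Fourier multiplier operator T_m is bounded from ℓ^p(ℤ) to ℓ^p(ℤ) for all 1 < p < ∞. -/

import Mathlib

open MeasureTheory Real Complex

/-- Discrete Fourier transform on `ℤ`: `F(f)(ξ) = ∑_{n ∈ ℤ} f(n) e^{2πi nξ}`. -/
noncomputable def dftZ (f : ℤ → ℂ) (ξ : ℝ) : ℂ :=
  ∑' n : ℤ, f n * Complex.exp (2 * Real.pi * Complex.I * (n : ℂ) * (ξ : ℂ))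

/-- The Fourier multiplier operator `T_m` on `ℤ`, given by `T_m f = F⁻¹(m · F(f))`. -/
noncomputable def TmultZ (m : ℝ → ℂ) (f : ℤ → ℂ) (n : ℤ) : ℂ :=
  ∫ ξ in Set.Ioo (0 : ℝ) 1, m ξ * dftZ f ξ *
    Complex.exp (-(2 * Real.pi * Complex.I) * (ξ : ℂ) * (n : ℂ))

/-- The `ℓ^p(ℤ)` norm, as the `L^p` norm with respect to counting measure. -/
noncomputable def lpNormZ (f : ℤ → ℂ) (p : ℝ) : ENNReal :=
  eLpNorm f (ENNReal.ofReal p) (Measure.count : Measure ℤ)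

open Finset in
/-- Calderón–Zygmund stopping intervals: intervals `[q.1, q.1 + q.2)` on which the average of `f`
first exceeds the height `t`, inside an interval of dyadic length. -/
theorem exists_stopping_intervals (f : ℤ → ℝ) (hf : ∀ n, 0 ≤ f n) (t : ℝ) :
    ∀ (N : ℕ) (a : ℤ), ∑ n ∈ Ico a (a + 2 ^ N), f n ≤ 2 * (t * 2 ^ N) →
    ∃ Q : Finset (ℤ × ℕ), (∀ q ∈ Q, 0 < q.2 ∧ Ico q.1 (q.1 + q.2) ⊆ Ico a (a + 2 ^ N) ∧
        t * q.2 < ∑ n ∈ Ico q.1 (q.1 + q.2), f n ∧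
        ∑ n ∈ Ico q.1 (q.1 + q.2), f n ≤ 2 * (t * q.2)) ∧
      (∀ q ∈ Q, ∀ r ∈ Q, q ≠ r → Disjoint (Ico q.1 (q.1 + q.2)) (Ico r.1 (r.1 + r.2))) ∧
      ∀ n ∈ Ico a (a + 2 ^ N), (∀ q ∈ Q, n ∉ Ico q.1 (q.1 + q.2)) → f n ≤ t := by
  intro N
  induction N with
  | zero =>
    intro a h
    have e : Ico a (a + 1) = {a} := by ext x; simp; omega
    by_cases hs : t < f a
    · refine ⟨{(a, 1)}, ?_, ?_, ?_⟩
      · simpa [e, hs] using h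
      · simp
      · intro n hn h'
        simp at h' hn
        omega
    · refine ⟨∅, by simp, by simp, ?_⟩
      simp [e]
      linarith
  | succ N ih =>
    intro a h
    by_cases hs : t * 2 ^ (N + 1) < ∑ n ∈ Ico a (a + 2 ^ (N + 1)), f n
    · refine ⟨{(a, 2 ^ (N + 1))}, ?_, ?_, ?_⟩
      · simp [hs, h]
      · simp
      · intro n hn h'
        simp at h' hn
        omega
    · have h2 : a + 2 ^ (N + 1) = a + 2 ^ N + 2 ^ N := by ring
      have hpos : (0 : ℤ) < 2 ^ N := by positivity
      have hdisj : Disjoint (Ico a (a + 2 ^ N)) (Ico (a + 2 ^ N) (a + 2 ^ N + 2 ^ N)) := by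
        rw [Finset.disjoint_left]; intro x; simp; omega
      have hunion : Ico a (a + 2 ^ (N + 1)) =
          Ico a (a + 2 ^ N) ∪ Ico (a + 2 ^ N) (a + 2 ^ N + 2 ^ N) := by
        ext x; simp [h2]; omega
      have hsum := sum_union hdisj (f := f)
      rw [← hunion] at hsum
      have hl₀ := sum_nonneg fun n (_ : n ∈ Ico a (a + 2 ^ N)) => hf n
      have hr₀ := sum_nonneg fun n (_ : n ∈ Ico (a + 2 ^ N) (a + 2 ^ N + 2 ^ N)) => hf n
      have hl : ∑ n ∈ Ico a (a + 2 ^ N), f n ≤ 2 * (t * 2 ^ N) := by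
        rw [pow_succ] at hs; linarith
      have hr : ∑ n ∈ Ico (a + 2 ^ N) (a + 2 ^ N + 2 ^ N), f n ≤ 2 * (t * 2 ^ N) := by
        rw [pow_succ] at hs; linarith
      obtain ⟨Q₁, hQ₁, hd₁, hs₁⟩ := ih a hl
      obtain ⟨Q₂, hQ₂, hd₂, hs₂⟩ := ih _ hr
      refine ⟨Q₁ ∪ Q₂, ?_, ?_, ?_⟩
      · intro q hq
        rw [hunion]
        rcases Finset.mem_union.1 hq with hq | hq
        · obtain ⟨h1, h2, h3⟩ := hQ₁ q hq
          exact ⟨h1, h2.trans subset_union_left, h3⟩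
        · obtain ⟨h1, h2, h3⟩ := hQ₂ q hq
          exact ⟨h1, h2.trans subset_union_right, h3⟩
      · intro q hq r hr hqr
        rcases Finset.mem_union.1 hq with hq | hq <;> rcases Finset.mem_union.1 hr with hr | hr
        · exact hd₁ q hq r hr hqr
        · exact disjoint_of_subset_left (hQ₁ q hq).2.1
            (disjoint_of_subset_right (hQ₂ r hr).2.1 hdisj)
        · exact disjoint_of_subset_left (hQ₂ q hq).2.1
            (disjoint_of_subset_right (hQ₁ r hr).2.1 hdisj.symm)
        · exact hd₂ q hq r hr hqr
      · intro n hn h'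
        rw [hunion] at hn
        rcases Finset.mem_union.1 hn with hn | hn
        · exact hs₁ n hn fun q hq => h' q (Finset.mem_union_left _ hq)
        · exact hs₂ n hn fun q hq => h' q (Finset.mem_union_right _ hq)

/-- A convolution kernel on `ℤ` which is bounded on `ℓ²` and satisfies the Hörmander condition. -/
structure IsCZKernel (K : ℤ → ℂ) (M B : ℝ) : Prop where
  nonneg : 0 ≤ M
  nonneg' : 0 ≤ B
  sq_le : ∀ (S A : Finset ℤ) (f : ℤ → ℂ),
    ∑ n ∈ A, ‖∑ k ∈ S, K (n - k) * f k‖ ^ 2 ≤ M * ∑ k ∈ S, ‖f k‖ ^ 2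
  sub_le : ∀ (L : ℕ) (h : ℤ) (A : Finset ℤ), |h| ≤ L → (∀ n ∈ A, 2 * (L : ℤ) ≤ |n|) →
    ∑ n ∈ A, ‖K (n - h) - K n‖ ≤ B

theorem IsCZKernel.transpose {K : ℤ → ℂ} {M B : ℝ} (hK : IsCZKernel K M B) :
    IsCZKernel (fun n => K (-n)) M B where
  nonneg := hK.nonneg
  nonneg' := hK.nonneg'
  sq_le S A f := by
    have := hK.sq_le (S.map (Equiv.neg ℤ).toEmbedding) (A.map (Equiv.neg ℤ).toEmbedding)
      (fun n => f (-n))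
    simp only [Finset.sum_map, Equiv.coe_toEmbedding, Equiv.neg_apply, neg_neg] at this
    convert this using 7
    ring
  sub_le L h A hh hA := by
    have := hK.sub_le L (-h) (A.map (Equiv.neg ℤ).toEmbedding) (by simpa using hh)
      (by intro n hn; simpa using hA (-n) (by simpa using hn))
    simp only [Finset.sum_map, Equiv.coe_toEmbedding, Equiv.neg_apply] at this
    convert this using 5
    ring

/-- The number of `n ∈ A` where `F` exceeds `t`, by the Chebyshev inequality. -/
theorem mul_card_filter_lt_le {ι : Type*} (A : Finset ι) (F : ι → ℝ) (hF : ∀ n ∈ A, 0 ≤ F n)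
    (t : ℝ) : t * (A.filter fun n => t < F n).card ≤ ∑ n ∈ A, F n := by
  rw [mul_comm, ← nsmul_eq_mul, ← Finset.sum_const]
  refine (Finset.sum_le_sum fun n hn => (Finset.mem_filter.1 hn).2.le).trans ?_
  exact Finset.sum_le_sum_of_subset_of_nonneg (Finset.filter_subset _ _) fun n hn _ => hF n hn

open Finset in
/-- A mean zero function on an interval of length `L` is mapped to a function with controlled
`ℓ¹` norm away from the double of the interval. -/
theorem IsCZKernel.sum_norm_le_of_sum_eq_zero {K : ℤ → ℂ} {M B : ℝ} (hK : IsCZKernel K M B)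
    (a : ℤ) (L : ℕ) (b : ℤ → ℂ) (hb : ∑ k ∈ Ico a (a + L), b k = 0) (A : Finset ℤ)
    (hA : ∀ n ∈ A, 2 * (L : ℤ) ≤ |n - a|) :
    ∑ n ∈ A, ‖∑ k ∈ Ico a (a + L), K (n - k) * b k‖ ≤ B * ∑ k ∈ Ico a (a + L), ‖b k‖ := by
  calc ∑ n ∈ A, ‖∑ k ∈ Ico a (a + L), K (n - k) * b k‖
      = ∑ n ∈ A, ‖∑ k ∈ Ico a (a + L), (K (n - k) - K (n - a)) * b k‖ := by
        refine sum_congr rfl fun n _ => ?_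
        simp_rw [sub_mul, sum_sub_distrib, ← mul_sum, hb, mul_zero, sub_zero]
    _ ≤ ∑ n ∈ A, ∑ k ∈ Ico a (a + L), ‖K (n - k) - K (n - a)‖ * ‖b k‖ := by
        refine sum_le_sum fun n _ => (norm_sum_le _ _).trans (le_of_eq ?_)
        simp
    _ = ∑ k ∈ Ico a (a + L), (∑ n ∈ A, ‖K (n - k) - K (n - a)‖) * ‖b k‖ := by
        rw [sum_comm]
        simp_rw [sum_mul]
    _ ≤ ∑ k ∈ Ico a (a + L), B * ‖b k‖ := by
        refine sum_le_sum fun k hk => mul_le_mul_of_nonneg_right ?_ (norm_nonneg _)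
        rw [mem_Ico] at hk
        have := hK.sub_le L (k - a) (A.map (Equiv.subRight a).toEmbedding)
          (by rw [abs_of_nonneg] <;> omega)
          (by intro n hn; simpa using hA (n + a) (by simpa using hn))
        simpa using this
    _ = _ := by rw [mul_sum]

open Finset in
/-- The weak type (1,1) inequality on intervals of dyadic length. -/
theorem IsCZKernel.weak_type_Ico {K : ℤ → ℂ} {M B : ℝ} (hK : IsCZKernel K M B)
    (f : ℤ → ℂ) (t : ℝ) (ht : 0 < t) (N : ℕ) (a : ℤ)
    (hN : ∑ n ∈ Ico a (a + 2 ^ N), ‖f n‖ ≤ 2 * (t * 2 ^ N)) (A : Finset ℤ) :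
    t * (A.filter fun n => 2 * t < ‖∑ k ∈ Ico a (a + 2 ^ N), K (n - k) * f k‖).card ≤
      (4 + 2 * B + 2 * M) * ∑ n ∈ Ico a (a + 2 ^ N), ‖f n‖ := by
  obtain ⟨Q, hQ, hdQ, hsQ⟩ := exists_stopping_intervals (fun n => ‖f n‖)
    (fun n => norm_nonneg _) t N a hN
  set I := Ico a (a + 2 ^ N) with hI
  let J : ℤ × ℕ → Finset ℤ := fun q => Ico q.1 (q.1 + q.2)
  let av : ℤ × ℕ → ℂ := fun q => (∑ n ∈ J q, f n) / q.2
  let b : ℤ × ℕ → ℤ → ℂ := fun q n => if n ∈ J q then f n - av q else 0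
  let g : ℤ → ℂ := fun n => f n - ∑ q ∈ Q, b q n
  let U := Q.biUnion J
  have hdisj : (Q : Set (ℤ × ℕ)).PairwiseDisjoint J := fun q hq r hr hqr => hdQ q hq r hr hqr
  have hcard : ∀ q : ℤ × ℕ, (J q).card = q.2 := by intro q; simp [J]
  have hUI : U ⊆ I := biUnion_subset.2 fun q hq => (hQ q hq).2.1
  have hsumU : ∑ q ∈ Q, ∑ n ∈ J q, ‖f n‖ ≤ ∑ n ∈ I, ‖f n‖ := by
    rw [← sum_biUnion hdisj]
    exact sum_le_sum_of_subset_of_nonneg hUI fun _ _ _ => norm_nonneg _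
  have hgU : ∀ q ∈ Q, ∀ n ∈ J q, g n = av q := by
    intro q hq n hn
    have : ∑ r ∈ Q, b r n = f n - av q := by
      rw [sum_eq_single_of_mem q hq]
      · simp [b, hn]
      · intro r hr hrq
        exact if_neg fun h => (disjoint_left.1 (hdisj hr hq hrq)) h hn
    simp [g, this]
  have hgV : ∀ n, n ∉ U → g n = f n := by
    intro n hn
    have : ∑ r ∈ Q, b r n = 0 := by
      refine sum_eq_zero fun r hr => if_neg fun h => hn (mem_biUnion.2 ⟨r, hr, h⟩)
    simp [g, this]
  have hav : ∀ q ∈ Q, q.2 * ‖av q‖ ≤ ∑ n ∈ J q, ‖f n‖ := by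
    intro q hq
    have : (0 : ℝ) < q.2 := by exact_mod_cast (hQ q hq).1
    simp only [av, norm_div, Complex.norm_natCast]
    rw [mul_div_cancel₀ _ this.ne']
    exact norm_sum_le _ _
  -- the good part
  have hg2 : ∑ n ∈ I, ‖g n‖ ^ 2 ≤ 2 * t * ∑ n ∈ I, ‖f n‖ := by
    rw [← sum_sdiff hUI, ← sum_sdiff (f := fun n => ‖f n‖) hUI, mul_add]
    refine add_le_add ?_ ?_
    · rw [mul_sum]
      refine sum_le_sum fun n hn => ?_
      rw [mem_sdiff] at hn
      rw [hgV n hn.2]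
      have : ‖f n‖ ≤ t := hsQ n hn.1 fun q hq h => hn.2 (mem_biUnion.2 ⟨q, hq, h⟩)
      nlinarith [norm_nonneg (f n)]
    · rw [sum_biUnion hdisj, sum_biUnion hdisj, mul_sum]
      refine sum_le_sum fun q hq => ?_
      have hL : (0 : ℝ) < q.2 := by exact_mod_cast (hQ q hq).1
      rw [sum_congr rfl fun n hn => by rw [hgU q hq n hn], sum_const, hcard, nsmul_eq_mul]
      have h1 := hav q hq
      have h2 : ‖av q‖ ≤ 2 * t := by
        have := (hQ q hq).2.2.2
        refine le_of_mul_le_mul_left ?_ hL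
        calc _ ≤ _ := h1
          _ ≤ _ := this
          _ = _ := by ring
      calc (q.2 : ℝ) * ‖av q‖ ^ 2 = ‖av q‖ * (q.2 * ‖av q‖) := by ring
        _ ≤ 2 * t * ∑ n ∈ J q, ‖f n‖ := by gcongr
  have hgood : t * (A.filter fun n => t < ‖∑ k ∈ I, K (n - k) * g k‖).card ≤
      2 * M * ∑ n ∈ I, ‖f n‖ := by
    have h1 := mul_card_filter_lt_le A (fun n => ‖∑ k ∈ I, K (n - k) * g k‖ ^ 2)
      (fun _ _ => by positivity) (t ^ 2)
    have h2 : (A.filter fun n => t ^ 2 < ‖∑ k ∈ I, K (n - k) * g k‖ ^ 2) =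
        (A.filter fun n => t < ‖∑ k ∈ I, K (n - k) * g k‖) := by
      refine filter_congr fun n _ => ?_
      rw [pow_lt_pow_iff_left₀ ht.le (norm_nonneg _) two_ne_zero]
    rw [h2] at h1
    have h3 := (h1.trans (hK.sq_le I A g)).trans (mul_le_mul_of_nonneg_left hg2 hK.nonneg)
    refine le_of_mul_le_mul_left ?_ ht
    linarith
  -- the bad part
  let E := Q.biUnion fun q => Ico (q.1 - 2 * (q.2 : ℤ)) (q.1 + 2 * (q.2 : ℤ))
  have hE : t * E.card ≤ 4 * ∑ n ∈ I, ‖f n‖ := by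
    have h1 : E.card ≤ ∑ q ∈ Q, 4 * q.2 := by
      refine card_biUnion_le.trans (sum_le_sum fun q _ => ?_)
      simp; omega
    have h2 : (E.card : ℝ) ≤ ∑ q ∈ Q, 4 * (q.2 : ℝ) := by exact_mod_cast h1
    calc t * E.card ≤ t * ∑ q ∈ Q, 4 * (q.2 : ℝ) := by gcongr
      _ = 4 * ∑ q ∈ Q, t * q.2 := by
        rw [mul_sum, mul_sum]; exact sum_congr rfl fun _ _ => by ring
      _ ≤ 4 * ∑ q ∈ Q, ∑ n ∈ J q, ‖f n‖ := by
        gcongr with q hq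
        exact (hQ q hq).2.2.1.le
      _ ≤ _ := by gcongr
  have hTb : ∀ q ∈ Q, ∀ n, ∑ k ∈ I, K (n - k) * b q k = ∑ k ∈ J q, K (n - k) * (f k - av q) := by
    intro q hq n
    simp only [b, mul_ite, mul_zero]
    rw [← sum_filter]
    congr 1
    rw [filter_mem_eq_inter, inter_eq_right]
    exact (hQ q hq).2.1
  have hbad : t * ((A \ E).filter fun n => t < ‖∑ q ∈ Q, ∑ k ∈ I, K (n - k) * b q k‖).card ≤
      2 * B * ∑ n ∈ I, ‖f n‖ := by
    refine (mul_card_filter_lt_le _ _ (fun _ _ => norm_nonneg _) t).trans ?_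
    calc ∑ n ∈ A \ E, ‖∑ q ∈ Q, ∑ k ∈ I, K (n - k) * b q k‖
        ≤ ∑ n ∈ A \ E, ∑ q ∈ Q, ‖∑ k ∈ I, K (n - k) * b q k‖ :=
          sum_le_sum fun n _ => norm_sum_le _ _
      _ = ∑ q ∈ Q, ∑ n ∈ A \ E, ‖∑ k ∈ J q, K (n - k) * (f k - av q)‖ := by
          rw [sum_comm]
          exact sum_congr rfl fun q hq => sum_congr rfl fun n _ => by rw [hTb q hq]
      _ ≤ ∑ q ∈ Q, B * ∑ k ∈ J q, ‖f k - av q‖ := by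
          refine sum_le_sum fun q hq => ?_
          have hL : (q.2 : ℂ) ≠ 0 := by exact_mod_cast (hQ q hq).1.ne'
          refine hK.sum_norm_le_of_sum_eq_zero q.1 q.2 (fun k => f k - av q) ?_ _ ?_
          · change ∑ k ∈ J q, (f k - av q) = 0
            rw [sum_sub_distrib, sum_const, hcard, nsmul_eq_mul]
            simp only [av]
            rw [mul_div_cancel₀ _ hL, sub_self]
          · intro n hn
            have h1 : n ∉ Ico (q.1 - 2 * (q.2 : ℤ)) (q.1 + 2 * (q.2 : ℤ)) := fun h =>
              (mem_sdiff.1 hn).2 (mem_biUnion.2 ⟨q, hq, h⟩)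
            rw [mem_Ico] at h1
            rw [le_abs]
            omega
      _ ≤ ∑ q ∈ Q, B * (2 * ∑ k ∈ J q, ‖f k‖) := by
          refine sum_le_sum fun q hq => mul_le_mul_of_nonneg_left ?_ hK.nonneg'
          refine (sum_le_sum fun k _ => norm_sub_le _ _).trans ?_
          rw [sum_add_distrib, sum_const, hcard, nsmul_eq_mul]
          linarith [hav q hq]
      _ = 2 * B * ∑ q ∈ Q, ∑ k ∈ J q, ‖f k‖ := by
          rw [mul_sum]; exact sum_congr rfl fun _ _ => by ring
      _ ≤ _ := by
          have := hK.nonneg'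
          gcongr
  have hsplit : ∀ n, ∑ k ∈ I, K (n - k) * f k =
      ∑ k ∈ I, K (n - k) * g k + ∑ q ∈ Q, ∑ k ∈ I, K (n - k) * b q k := by
    intro n
    rw [sum_comm (s := Q), ← sum_add_distrib]
    refine sum_congr rfl fun k _ => ?_
    rw [← mul_sum, ← mul_add]
    simp [g]
  have hsub : (A.filter fun n => 2 * t < ‖∑ k ∈ I, K (n - k) * f k‖) ⊆
      E ∪ ((A \ E).filter fun n => t < ‖∑ q ∈ Q, ∑ k ∈ I, K (n - k) * b q k‖) ∪
        (A.filter fun n => t < ‖∑ k ∈ I, K (n - k) * g k‖) := by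
    intro n hn
    obtain ⟨hnA, hn⟩ := mem_filter.1 hn
    rw [hsplit] at hn
    have h1 := norm_add_le (∑ k ∈ I, K (n - k) * g k) (∑ q ∈ Q, ∑ k ∈ I, K (n - k) * b q k)
    by_cases hnE : n ∈ E
    · simp [hnE]
    · by_cases hg : t < ‖∑ k ∈ I, K (n - k) * g k‖
      · exact mem_union_right _ (mem_filter.2 ⟨hnA, hg⟩)
      · refine mem_union_left _ (mem_union_right _ (mem_filter.2 ⟨mem_sdiff.2 ⟨hnA, hnE⟩, ?_⟩))
        linarith
  have hc := (card_le_card hsub).trans ((card_union_le _ _).trans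
    (Nat.add_le_add_right (card_union_le _ _) _))
  have hc' : ((A.filter fun n => 2 * t < ‖∑ k ∈ I, K (n - k) * f k‖).card : ℝ) ≤
    E.card + ((A \ E).filter fun n => t < ‖∑ q ∈ Q, ∑ k ∈ I, K (n - k) * b q k‖).card +
        (A.filter fun n => t < ‖∑ k ∈ I, K (n - k) * g k‖).card := by exact_mod_cast hc
  have := mul_le_mul_of_nonneg_left hc' ht.le
  linarith

open Finset in
/-- The weak type (1,1) inequality. -/
theorem IsCZKernel.weak_type {K : ℤ → ℂ} {M B : ℝ} (hK : IsCZKernel K M B)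
    (f : ℤ → ℂ) (t : ℝ) (ht : 0 < t) (S A : Finset ℤ) :
    t * (A.filter fun n => 2 * t < ‖∑ k ∈ S, K (n - k) * f k‖).card ≤
      (4 + 2 * B + 2 * M) * ∑ n ∈ S, ‖f n‖ := by
  obtain ⟨R, hR⟩ : ∃ R : ℕ, ∀ n ∈ S, |n| ≤ R := by
    refine ⟨S.sup fun n => n.natAbs, fun n hn => ?_⟩
    have : n.natAbs ≤ S.sup fun n => n.natAbs := le_sup (f := fun n : ℤ => n.natAbs) hn
    rw [Int.abs_eq_natAbs]
    exact_mod_cast this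
  obtain ⟨R', hR'⟩ := exists_nat_ge ((∑ n ∈ S, ‖f n‖) / t)
  obtain ⟨N, hN⟩ : ∃ N : ℕ, (2 * R + 1 + R' : ℤ) < 2 ^ N :=
    ⟨2 * R + 1 + R', by exact_mod_cast Nat.lt_two_pow_self⟩
  have hSI : S ⊆ Ico (-R : ℤ) (-R + 2 ^ N) := by
    intro n hn
    have := abs_le.1 (hR n hn)
    rw [mem_Ico]
    omega
  have hnorm : ∑ n ∈ Ico (-R : ℤ) (-R + 2 ^ N), ‖if n ∈ S then f n else 0‖ = ∑ n ∈ S, ‖f n‖ := by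
    rw [← sum_subset hSI]
    · exact sum_congr rfl fun n hn => by simp [hn]
    · intro n _ hn; simp [hn]
  have hT : ∀ n, ∑ k ∈ Ico (-R : ℤ) (-R + 2 ^ N), K (n - k) * (if k ∈ S then f k else 0) =
      ∑ k ∈ S, K (n - k) * f k := by
    intro n
    rw [← sum_subset hSI]
    · exact sum_congr rfl fun n hn => by simp [hn]
    · intro n _ hn; simp [hn]
  have := hK.weak_type_Ico (fun n => if n ∈ S then f n else 0) t ht N (-R) ?_ A
  · simpa only [hT, hnorm] using this
  · rw [hnorm]
    have h1 : (R' : ℝ) ≤ 2 ^ N := by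
      have : (R' : ℤ) ≤ 2 ^ N := by omega
      exact_mod_cast this
    rw [div_le_iff₀ ht] at hR'
    nlinarith

open Set in
theorem integrableOn_ite_lt_rpow {s : ℝ} (hs : -1 < s) {x : ℝ} (hx : 0 ≤ x) :
    IntegrableOn (fun t : ℝ => if t < x then t ^ s else 0) (Ioi 0) ∧
      ∫ t in Ioi (0 : ℝ), (if t < x then t ^ s else 0) = x ^ (s + 1) / (s + 1) := by
  have h1 : (fun t : ℝ => if t < x then t ^ s else 0) = (Iio x).indicator fun t => t ^ s := by
    ext t; simp [indicator]
  have h2 : Ioi (0 : ℝ) ∩ Iio x = Ioo 0 x := Ioi_inter_Iio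
  have h3 := intervalIntegral.intervalIntegrable_rpow' (a := 0) (b := x) hs
  rw [intervalIntegrable_iff_integrableOn_Ioo_of_le hx] at h3
  rw [h1]
  constructor
  · rw [IntegrableOn, integrable_indicator_iff measurableSet_Iio, IntegrableOn,
      Measure.restrict_restrict measurableSet_Iio, inter_comm, h2]
    exact h3
  · rw [setIntegral_indicator measurableSet_Iio, h2, ← integral_Ioc_eq_integral_Ioo,
      ← intervalIntegral.integral_of_le hx, integral_rpow (Or.inl hs),
      Real.zero_rpow (by linarith), sub_zero]

open Set in
theorem integrableOn_ite_le_rpow {s : ℝ} (hs : s < -1) {x : ℝ} (hx : 0 < x) :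
    IntegrableOn (fun t : ℝ => if t < x then 0 else t ^ s) (Ioi 0) ∧
      ∫ t in Ioi (0 : ℝ), (if t < x then 0 else t ^ s) = -x ^ (s + 1) / (s + 1) := by
  have h1 : (fun t : ℝ => if t < x then 0 else t ^ s) = (Ici x).indicator fun t => t ^ s := by
    ext t
    by_cases h : t < x
    · simp [indicator, h]
    · simp [indicator, h, not_lt.1 h]
  have h2 : Ioi (0 : ℝ) ∩ Ici x = Ici x := inter_eq_right.2 fun t ht => hx.trans_le ht
  have h3 := integrableOn_Ioi_rpow_of_lt hs hx
  rw [← integrableOn_Ici_iff_integrableOn_Ioi] at h3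
  rw [h1]
  constructor
  · rw [IntegrableOn, integrable_indicator_iff measurableSet_Ici, IntegrableOn,
      Measure.restrict_restrict measurableSet_Ici, inter_comm, h2]
    exact h3
  · rw [setIntegral_indicator measurableSet_Ici, h2, integral_Ici_eq_integral_Ioi,
      integral_Ioi_rpow_of_lt hs hx]

open Finset in
/-- The distribution estimate behind Marcinkiewicz interpolation. -/
theorem IsCZKernel.mul_card_le {K : ℤ → ℂ} {M B : ℝ} (hK : IsCZKernel K M B)
    (f : ℤ → ℂ) (t : ℝ) (ht : 0 < t) (S A : Finset ℤ) :
    t * (A.filter fun n => 3 * t < ‖∑ k ∈ S, K (n - k) * f k‖).card ≤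
      ∑ n ∈ S, ((4 + 2 * B + 2 * M) * (if t < ‖f n‖ then ‖f n‖ else 0) +
        M / t * (if t < ‖f n‖ then 0 else ‖f n‖ ^ 2)) := by
  have h1 := hK.weak_type f t ht (S.filter fun n => t < ‖f n‖) A
  have h2 := (mul_card_filter_lt_le A
      (fun n => ‖∑ k ∈ S.filter fun n => ¬ t < ‖f n‖, K (n - k) * f k‖ ^ 2)
      (fun _ _ => by positivity) (t ^ 2)).trans (hK.sq_le _ A f)
  have h3 : (A.filter fun n => 3 * t < ‖∑ k ∈ S, K (n - k) * f k‖) ⊆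
      (A.filter fun n => 2 * t < ‖∑ k ∈ S.filter fun n => t < ‖f n‖, K (n - k) * f k‖) ∪
      (A.filter fun n => t ^ 2 < ‖∑ k ∈ S.filter fun n => ¬ t < ‖f n‖, K (n - k) * f k‖ ^ 2) := by
    intro n hn
    obtain ⟨hnA, hn⟩ := mem_filter.1 hn
    rw [← sum_filter_add_sum_filter_not S fun n => t < ‖f n‖] at hn
    have := norm_add_le (∑ k ∈ S.filter fun n => t < ‖f n‖, K (n - k) * f k)
      (∑ k ∈ S.filter fun n => ¬ t < ‖f n‖, K (n - k) * f k)
    by_cases h : 2 * t < ‖∑ k ∈ S.filter fun n => t < ‖f n‖, K (n - k) * f k‖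
    · exact mem_union_left _ (mem_filter.2 ⟨hnA, h⟩)
    · refine mem_union_right _ (mem_filter.2 ⟨hnA, ?_⟩)
      exact pow_lt_pow_left₀ (by linarith) ht.le two_ne_zero
  have h4 := (Nat.cast_le (α := ℝ)).2 ((card_le_card h3).trans (card_union_le _ _))
  rw [Nat.cast_add] at h4
  rw [sum_filter] at h1 h2
  rw [sum_add_distrib, ← mul_sum, ← mul_sum]
  simp only [ite_not] at h1 h2
  have h5 : t * (A.filter fun n =>
      t ^ 2 < ‖∑ k ∈ S.filter fun n => ¬ t < ‖f n‖, K (n - k) * f k‖ ^ 2).card ≤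
      M / t * ∑ n ∈ S, (if t < ‖f n‖ then 0 else ‖f n‖ ^ 2) := by
    refine le_of_mul_le_mul_left ?_ ht
    calc _ = t ^ 2 * ((A.filter fun n =>
      t ^ 2 < ‖∑ k ∈ S.filter fun n => ¬ t < ‖f n‖, K (n - k) * f k‖ ^ 2).card : ℝ) := by ring
      _ ≤ _ := h2
      _ = _ := by field_simp
  have h6 := mul_le_mul_of_nonneg_left h4 ht.le
  rw [mul_add] at h6
  linarith

open Set in
/-- Marcinkiewicz interpolation between the weak type (1,1) inequality and the `ℓ²` bound. -/
theorem IsCZKernel.strong_type_of_lt_two {K : ℤ → ℂ} {M B : ℝ} (hK : IsCZKernel K M B)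
    {p : ℝ} (hp : 1 < p) (hp2 : p < 2) (S A : Finset ℤ) (f : ℤ → ℂ) :
    ∑ n ∈ A, ‖∑ k ∈ S, K (n - k) * f k‖ ^ p ≤
      3 ^ p * p * ((4 + 2 * B + 2 * M) / (p - 1) + M / (2 - p)) * ∑ n ∈ S, ‖f n‖ ^ p := by
  set W := 4 + 2 * B + 2 * M with hW
  let u : ℤ → ℝ := fun n => ‖∑ k ∈ S, K (n - k) * f k‖ / 3
  have hu : ∀ n, 0 ≤ u n := fun n => by positivity
  have hp0 : p ≠ 0 := by linarith
  have hL := fun n => integrableOn_ite_lt_rpow (s := p - 1) (by linarith) (hu n)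
  have h1 : ∀ n, IntegrableOn (fun t : ℝ => W * (‖f n‖ * if t < ‖f n‖ then t ^ (p - 2) else 0) +
      M * (‖f n‖ ^ 2 * if t < ‖f n‖ then 0 else t ^ (p - 3))) (Ioi 0) ∧
      ∫ t in Ioi (0 : ℝ), (W * (‖f n‖ * if t < ‖f n‖ then t ^ (p - 2) else 0) +
        M * (‖f n‖ ^ 2 * if t < ‖f n‖ then 0 else t ^ (p - 3))) =
        (W / (p - 1) + M / (2 - p)) * ‖f n‖ ^ p := by
    intro n
    rcases (norm_nonneg (f n)).eq_or_lt with h | h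
    · simp [← h, Real.zero_rpow hp0]
    · obtain ⟨i1, e1⟩ := integrableOn_ite_lt_rpow (s := p - 2) (by linarith) h.le
      obtain ⟨i2, e2⟩ := integrableOn_ite_le_rpow (s := p - 3) (by linarith) h
      refine ⟨((i1.const_mul _).const_mul _).add ((i2.const_mul _).const_mul _), ?_⟩
      rw [integral_add ((i1.const_mul _).const_mul _) ((i2.const_mul _).const_mul _)]
      simp only [integral_const_mul]
      rw [e1, e2]
      have e3 : ‖f n‖ * ‖f n‖ ^ (p - 2 + 1) = ‖f n‖ ^ p := by
        nth_rw 1 [← Real.rpow_one ‖f n‖]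
        rw [← Real.rpow_add h]; congr 1; ring
      have e4 : ‖f n‖ ^ 2 * ‖f n‖ ^ (p - 3 + 1) = ‖f n‖ ^ p := by
        rw [← Real.rpow_natCast, ← Real.rpow_add h]; congr 1; push_cast; ring
      calc _ = W * (‖f n‖ * ‖f n‖ ^ (p - 2 + 1)) / (p - 2 + 1) -
            M * (‖f n‖ ^ 2 * ‖f n‖ ^ (p - 3 + 1)) / (p - 3 + 1) := by ring
        _ = _ := by
          rw [e3, e4]
          have a1 : p - 2 + 1 = p - 1 := by ring
          have a2 : p - 3 + 1 = -(2 - p) := by ring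
          rw [a1, a2, div_neg]
          ring
  have key : ∫ t in Ioi (0 : ℝ), ∑ n ∈ A, (if t < u n then t ^ (p - 1) else 0) ≤
      ∫ t in Ioi (0 : ℝ), ∑ n ∈ S, (W * (‖f n‖ * if t < ‖f n‖ then t ^ (p - 2) else 0) +
        M * (‖f n‖ ^ 2 * if t < ‖f n‖ then 0 else t ^ (p - 3))) := by
    refine setIntegral_mono_on (integrable_finsetSum _ fun n _ => (hL n).1)
      (integrable_finsetSum _ fun n _ => (h1 n).1) measurableSet_Ioi fun t ht => ?_
    have ht : 0 < t := ht
    have h2 := mul_le_mul_of_nonneg_left (hK.mul_card_le f t ht S A)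
      (Real.rpow_nonneg ht.le (p - 2))
    have e1 : t ^ (p - 2) * t = t ^ (p - 1) := by
      nth_rw 2 [← Real.rpow_one t]
      rw [← Real.rpow_add ht]; congr 1; ring
    have e2 : t ^ (p - 2) / t = t ^ (p - 3) := by
      nth_rw 2 [← Real.rpow_one t]
      rw [← Real.rpow_sub ht]; congr 1; ring
    rw [← mul_assoc, e1, Finset.mul_sum] at h2
    convert h2 using 1
    · rw [← Finset.sum_filter, Finset.sum_const, nsmul_eq_mul, mul_comm]
      congr 3
      refine Finset.filter_congr fun n _ => ?_
      rw [lt_div_iff₀ (by norm_num), mul_comm]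
    · refine Finset.sum_congr rfl fun n _ => ?_
      rw [← e2]
      split_ifs <;> ring
  rw [integral_finsetSum _ fun n _ => (hL n).1, integral_finsetSum _ fun n _ => (h1 n).1,
    Finset.sum_congr rfl fun n _ => (hL n).2, Finset.sum_congr rfl fun n _ => (h1 n).2,
    ← Finset.mul_sum] at key
  have e : ∀ n, ‖∑ k ∈ S, K (n - k) * f k‖ ^ p = 3 ^ p * p * (u n ^ (p - 1 + 1) / (p - 1 + 1)) := by
    intro n
    have : p - 1 + 1 = p := by ring
    rw [this, Real.div_rpow (norm_nonneg _) (by norm_num)]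
    have : (3 : ℝ) ^ p ≠ 0 := by positivity
    field_simp
  simp_rw [e]
  rw [← Finset.mul_sum]
  exact (mul_le_mul_of_nonneg_left key (by positivity)).trans_eq (by ring)

/-- Calderón–Zygmund kernels are bounded on `ℓᵖ` for `1 < p ≤ 2`. -/
theorem IsCZKernel.strong_type_of_le_two {K : ℤ → ℂ} {M B : ℝ} (hK : IsCZKernel K M B)
    {p : ℝ} (hp : 1 < p) (hp2 : p ≤ 2) : ∃ C : ℝ, 0 ≤ C ∧ ∀ (S A : Finset ℤ) (f : ℤ → ℂ),
    ∑ n ∈ A, ‖∑ k ∈ S, K (n - k) * f k‖ ^ p ≤ C * ∑ n ∈ S, ‖f n‖ ^ p := by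
  have h1 := hK.nonneg
  have h2 := hK.nonneg'
  rcases hp2.eq_or_lt with rfl | hp2
  · exact ⟨M, h1, fun S A f => by simpa using hK.sq_le S A f⟩
  · refine ⟨_, ?_, fun S A f => hK.strong_type_of_lt_two hp hp2 S A f⟩
    have : 0 < p - 1 := by linarith
    have : 0 < 2 - p := by linarith
    positivity

/-- Calderón–Zygmund kernels are bounded on `ℓᵖ` for `2 < p`, by duality. -/
theorem IsCZKernel.strong_type_of_two_lt {K : ℤ → ℂ} {M B : ℝ} (hK : IsCZKernel K M B)
    {p : ℝ} (hp : 2 < p) : ∃ C : ℝ, 0 ≤ C ∧ ∀ (S A : Finset ℤ) (f : ℤ → ℂ),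
    ∑ n ∈ A, ‖∑ k ∈ S, K (n - k) * f k‖ ^ p ≤ C * ∑ n ∈ S, ‖f n‖ ^ p := by
  have hpq : p.HolderConjugate p.conjExponent := Real.HolderConjugate.conjExponent (by linarith)
  set q := p.conjExponent with hq
  have hq2 : q ≤ 2 := by
    rw [hq, Real.conjExponent, div_le_iff₀ (by linarith)]; linarith
  obtain ⟨C, hC, hCq⟩ := hK.transpose.strong_type_of_le_two hpq.symm.lt hq2
  refine ⟨(C ^ (1 / q)) ^ p, by positivity, fun S A f => ?_⟩
  set F : ℤ → ℂ := fun n => ∑ k ∈ S, K (n - k) * f k with hF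
  let g : ℤ → ℂ := fun n => (‖F n‖ ^ (p - 2) : ℝ) * (starRingEnd ℂ) (F n)
  set X := ∑ n ∈ A, ‖F n‖ ^ p with hX
  set Y := ∑ n ∈ S, ‖f n‖ ^ p with hY
  have hX0 : 0 ≤ X := Finset.sum_nonneg fun n _ => by positivity
  have hY0 : 0 ≤ Y := Finset.sum_nonneg fun n _ => by positivity
  have hgF : ∀ n, F n * g n = ((‖F n‖ ^ p : ℝ) : ℂ) := by
    intro n
    have h1 : F n * g n = ((‖F n‖ ^ (p - 2) * ‖F n‖ ^ 2 : ℝ) : ℂ) := by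
      simp only [g]
      rw [mul_left_comm, Complex.mul_conj, Complex.normSq_eq_norm_sq]
      push_cast; ring
    rw [h1]
    congr 1
    rcases (norm_nonneg (F n)).eq_or_lt with h | h
    · rw [← h, Real.zero_rpow (by linarith : p ≠ 0)]; simp
    · rw [← Real.rpow_natCast, ← Real.rpow_add h]; congr 1; push_cast; ring
  have hgn : ∀ n, ‖g n‖ ^ q = ‖F n‖ ^ p := by
    intro n
    have h1 : ‖g n‖ = ‖F n‖ ^ (p - 1) := by
      simp only [g, norm_mul, Complex.norm_real, RCLike.norm_conj, Real.norm_eq_abs]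
      rw [abs_of_nonneg (by positivity)]
      rcases (norm_nonneg (F n)).eq_or_lt with h | h
      · rw [← h, mul_zero, Real.zero_rpow (by linarith)]
      · nth_rw 2 [← Real.rpow_one ‖F n‖]
        rw [← Real.rpow_add h]; congr 1; ring
    rw [h1, ← Real.rpow_mul (norm_nonneg _), hpq.sub_one_mul_conj]
  have hdual : (X : ℂ) = ∑ k ∈ S, f k * ∑ n ∈ A, K (-(k - n)) * g n := by
    rw [hX]
    push_cast
    rw [Finset.sum_congr rfl fun n _ => by exact_mod_cast (hgF n).symm]
    simp only [hF, Finset.sum_mul, Finset.mul_sum]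
    rw [Finset.sum_comm]
    refine Finset.sum_congr rfl fun k _ => Finset.sum_congr rfl fun n _ => ?_
    rw [neg_sub]; ring
  have hXle : X ≤ Y ^ (1 / p) * (C ^ (1 / q) * X ^ (1 / q)) := by
    calc X = ‖(X : ℂ)‖ := by rw [Complex.norm_real, Real.norm_of_nonneg hX0]
      _ ≤ ∑ k ∈ S, ‖f k‖ * ‖∑ n ∈ A, K (-(k - n)) * g n‖ := by
          rw [hdual]
          refine (norm_sum_le _ _).trans (le_of_eq ?_)
          simp only [norm_mul]
      _ ≤ Y ^ (1 / p) * (∑ k ∈ S, ‖∑ n ∈ A, K (-(k - n)) * g n‖ ^ q) ^ (1 / q) :=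
          Real.inner_le_Lp_mul_Lq_of_nonneg S hpq (fun _ _ => norm_nonneg _)
            (fun _ _ => norm_nonneg _)
      _ ≤ Y ^ (1 / p) * (C * X) ^ (1 / q) := by
          have h2 := hCq A S g
          rw [Finset.sum_congr rfl fun n _ => hgn n] at h2
          have h3 := hpq.symm.pos
          refine mul_le_mul_of_nonneg_left ?_ (by positivity)
          refine Real.rpow_le_rpow (Finset.sum_nonneg fun _ _ => by positivity) h2 (by positivity)
      _ = _ := by rw [Real.mul_rpow hC hX0]
  rcases hX0.eq_or_lt with h | h
  · rw [← h]; positivity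
  · have h4 : X ^ (1 / p) ≤ C ^ (1 / q) * Y ^ (1 / p) := by
      have h5 : X ^ (1 / p) * X ^ (1 / q) = X := by
        rw [← Real.rpow_add h, one_div, one_div, hpq.inv_add_inv_eq_one, Real.rpow_one]
      have h6 : 0 < X ^ (1 / q) := by positivity
      refine le_of_mul_le_mul_right ?_ h6
      rw [h5]; linarith
    have h7 := Real.rpow_le_rpow (by positivity) h4 (by linarith : (0 : ℝ) ≤ p)
    rwa [Real.mul_rpow (by positivity) (by positivity), ← Real.rpow_mul hX0, ← Real.rpow_mul hY0,
      one_div_mul_cancel (by linarith), Real.rpow_one, Real.rpow_one] at h7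

theorem fourierCoeffOn_zero_one (f : ℝ → ℂ) (n : ℤ) :
    fourierCoeffOn zero_lt_one f n =
      ∫ x in (0 : ℝ)..1, Complex.exp (2 * π * I * (-n : ℤ) * x) * f x := by
  rw [fourierCoeffOn_eq_integral]
  simp only [sub_zero, div_one, one_smul, smul_eq_mul]
  refine intervalIntegral.integral_congr fun x _ => ?_
  rw [fourier_coe_apply]
  congr 2
  push_cast; ring

theorem norm_exp_two_pi_I_mul (n : ℤ) (x : ℝ) : ‖Complex.exp (2 * π * I * n * x)‖ = 1 := by
  have : (2 * π * I * n * x : ℂ) = ((2 * π * n * x : ℝ) : ℂ) * I := by push_cast; ring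
  rw [this, Complex.norm_exp_ofReal_mul_I]

theorem integral_exp_two_pi_I_mul (n : ℤ) :
    ∫ x in (0 : ℝ)..1, Complex.exp (2 * π * I * n * x) = if n = 0 then 1 else 0 := by
  split_ifs with h
  · simp [h]
  · have h1 : (2 * π * I * n : ℂ) ≠ 0 := by
      simp [h, Real.pi_ne_zero]
    rw [integral_exp_mul_complex h1]
    have h2 : Complex.exp (2 * π * I * n * (1 : ℝ)) = 1 := by
      rw [Complex.exp_eq_one_iff]
      exact ⟨n, by push_cast; ring⟩
    rw [h2]; simp

/-- `ℓ²` boundedness of the Fourier multiplier with bounded symbol, on finite sums. -/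
theorem sum_sq_fourierCoeffOn_conv_le {m : ℝ → ℂ} {M : ℝ}
    (hm : AEStronglyMeasurable m (volume.restrict (Set.Ioc 0 1)))
    (hM : ∀ᵐ x ∂volume.restrict (Set.Ioc (0 : ℝ) 1), ‖m x‖ ≤ M)
    (S A : Finset ℤ) (f : ℤ → ℂ) :
    ∑ n ∈ A, ‖∑ k ∈ S, fourierCoeffOn zero_lt_one m (n - k) * f k‖ ^ 2 ≤
      M ^ 2 * ∑ k ∈ S, ‖f k‖ ^ 2 := by
  let P : ℝ → ℂ := fun x => ∑ k ∈ S, f k * Complex.exp (2 * π * I * k * x)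
  have hP : Continuous P := by fun_prop
  have hexp : ∀ (n k : ℤ) (x : ℝ), Complex.exp (2 * π * I * (-n : ℤ) * x) *
      Complex.exp (2 * π * I * k * x) = Complex.exp (2 * π * I * (-(n - k) : ℤ) * x) := by
    intro n k x
    rw [← Complex.exp_add]; congr 1; push_cast; ring
  have hmI : IntervalIntegrable m volume 0 1 := by
    rw [intervalIntegrable_iff_integrableOn_Ioc_of_le zero_le_one]
    exact Integrable.of_bound hm M hM
  have hcoeff : ∀ (u : ℝ → ℂ), IntervalIntegrable u volume 0 1 → ∀ n,
      fourierCoeffOn zero_lt_one (fun x => u x * P x) n =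
      ∑ k ∈ S, fourierCoeffOn zero_lt_one u (n - k) * f k := by
    intro u hu n
    simp only [fourierCoeffOn_zero_one]
    have : ∀ k ∈ S, IntervalIntegrable
        (fun x => Complex.exp (2 * π * I * (-(n - k) : ℤ) * x) * u x * f k) volume 0 1 :=
      fun k _ => (hu.continuousOn_mul (by fun_prop)).mul_const _
    simp_rw [← intervalIntegral.integral_mul_const]
    rw [← intervalIntegral.integral_finsetSum this]
    refine intervalIntegral.integral_congr fun x _ => ?_
    simp only [P, Finset.mul_sum]
    refine Finset.sum_congr rfl fun k _ => ?_
    rw [← hexp]; ring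
  obtain ⟨R, hR⟩ := isCompact_Icc.exists_bound_of_continuousOn (hP.continuousOn (s := Set.Icc 0 1))
  have hPb : ∀ᵐ x ∂volume.restrict (Set.Ioc (0 : ℝ) 1), ‖P x‖ ≤ R := by
    filter_upwards [ae_restrict_mem measurableSet_Ioc] with x hx
    exact hR x (Set.Ioc_subset_Icc_self hx)
  have hPL : MemLp P 2 (volume.restrict (Set.Ioc 0 1)) :=
    MemLp.of_bound hP.aestronglyMeasurable R hPb
  have hGL : MemLp (fun x => m x * P x) 2 (volume.restrict (Set.Ioc 0 1)) := by
    refine MemLp.of_bound (hm.mul hP.aestronglyMeasurable) (M * R) ?_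
    filter_upwards [hPb, hM] with x h1 h2
    rw [norm_mul]
    exact mul_le_mul h2 h1 (norm_nonneg _) ((norm_nonneg _).trans h2)
  have h1 := hasSum_sq_fourierCoeffOn zero_lt_one hGL
  have h2 := hasSum_sq_fourierCoeffOn zero_lt_one hPL
  have h3 : ∀ n, fourierCoeffOn zero_lt_one P n = if n ∈ S then f n else 0 := by
    intro n
    have := hcoeff (fun _ => 1) (by simp) n
    simp only [one_mul] at this
    rw [show P = fun x => P x from rfl, this]
    simp only [fourierCoeffOn_zero_one, mul_one, integral_exp_two_pi_I_mul, neg_eq_zero,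
      sub_eq_zero, ite_mul, one_mul, zero_mul, Finset.sum_ite_eq]
  have h4 : ∑ k ∈ S, ‖f k‖ ^ 2 = ∫ x in (0 : ℝ)..1, ‖P x‖ ^ 2 := by
    have h5 : HasSum (fun n => ‖fourierCoeffOn zero_lt_one P n‖ ^ 2) (∑ k ∈ S, ‖f k‖ ^ 2) := by
      have h6 : HasSum (fun n => ‖fourierCoeffOn zero_lt_one P n‖ ^ 2)
          (∑ n ∈ S, ‖fourierCoeffOn zero_lt_one P n‖ ^ 2) :=
        hasSum_sum_of_ne_finset_zero fun n hn => by simp [h3, hn]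
      rwa [Finset.sum_congr rfl fun n hn => by rw [h3, if_pos hn]] at h6
    simpa using h5.unique h2
  calc _ = ∑ n ∈ A, ‖fourierCoeffOn zero_lt_one (fun x => m x * P x) n‖ ^ 2 := by
        simp_rw [hcoeff m hmI]
    _ ≤ ∫ x in (0 : ℝ)..1, ‖m x * P x‖ ^ 2 := by
        simpa using sum_le_hasSum A (fun _ _ => by positivity) h1
    _ ≤ ∫ x in (0 : ℝ)..1, M ^ 2 * ‖P x‖ ^ 2 := by
        rw [intervalIntegral.integral_of_le zero_le_one,
          intervalIntegral.integral_of_le zero_le_one]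
        refine integral_mono_ae hGL.norm.integrable_sq (hPL.norm.integrable_sq.const_mul _) ?_
        filter_upwards [hM] with x h2
        rw [norm_mul, mul_pow]
        gcongr
    _ = _ := by rw [intervalIntegral.integral_const_mul, h4]

/-- Square integral bound for the profile `L / (1 + L x (1 - x))`. -/
theorem integral_sq_profile_le (L : ℝ) (hL : 0 ≤ L) :
    ∫ x in (0 : ℝ)..1, (L / (1 + L * (x * (1 - x)))) ^ 2 ≤ 4 * L := by
  have h1 : ∀ x ∈ Set.uIcc (0 : ℝ) 1,
      HasDerivAt (fun x => 2 * L / (1 + L * (1 - x) / 2) - 2 * L / (1 + L * x / 2))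
        ((L / (1 + L * (1 - x) / 2)) ^ 2 + (L / (1 + L * x / 2)) ^ 2) x := by
    intro x hx
    rw [Set.uIcc_of_le zero_le_one] at hx
    have hx1 : 0 ≤ 1 - x := by linarith [hx.2]
    have hx0 := hx.1
    have d1 : (1 + L * (1 - x) / 2) ≠ 0 := by positivity
    have d2 : (1 + L * x / 2) ≠ 0 := by positivity
    have e1 : HasDerivAt (fun x => 1 + L * (1 - x) / 2) (-(L / 2)) x := by
      have h := (((hasDerivAt_id' x).const_sub 1).const_mul (L / 2)).const_add 1
      rw [show (fun x => 1 + L * (1 - x) / 2) = fun x => 1 + L / 2 * (1 - x) by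
        funext y; ring]
      exact h.congr_deriv (by ring)
    have e2 : HasDerivAt (fun x => 1 + L * x / 2) (L / 2) x := by
      have h := ((hasDerivAt_id' x).const_mul (L / 2)).const_add 1
      rw [show (fun x => 1 + L * x / 2) = fun x => 1 + L / 2 * x by funext y; ring]
      exact h.congr_deriv (by ring)
    refine (((hasDerivAt_const x (2 * L)).div e1 d1).sub
      ((hasDerivAt_const x (2 * L)).div e2 d2)).congr_deriv ?_
    field_simp
    ring
  have hc1 : ContinuousOn (fun x => (L / (1 + L * (1 - x) / 2)) ^ 2 + (L / (1 + L * x / 2)) ^ 2)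
      (Set.uIcc (0 : ℝ) 1) := by
    rw [Set.uIcc_of_le zero_le_one]
    refine ((continuousOn_const.div (by fun_prop) fun x hx => ?_).pow 2).add
      ((continuousOn_const.div (by fun_prop) fun x hx => ?_).pow 2)
    · have hx1 : 0 ≤ 1 - x := by linarith [hx.2]
      positivity
    · have hx0 := hx.1
      positivity
  have hc2 : ContinuousOn (fun x => (L / (1 + L * (x * (1 - x)))) ^ 2) (Set.uIcc (0 : ℝ) 1) := by
    rw [Set.uIcc_of_le zero_le_one]
    refine (continuousOn_const.div (by fun_prop) fun x hx => ?_).pow 2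
    have hx1 : 0 ≤ 1 - x := by linarith [hx.2]
    have hx0 := hx.1
    positivity
  calc _ ≤ ∫ x in (0 : ℝ)..1, ((L / (1 + L * (1 - x) / 2)) ^ 2 + (L / (1 + L * x / 2)) ^ 2) := by
        refine intervalIntegral.integral_mono_on zero_le_one hc2.intervalIntegrable
          hc1.intervalIntegrable fun x hx => ?_
        have hx0 := hx.1
        have hx1 : 0 ≤ 1 - x := by linarith [hx.2]
        rcases le_total x (1 / 2) with h | h
        · refine le_add_of_nonneg_of_le (by positivity) ?_
          have : L * x / 2 ≤ L * (x * (1 - x)) := by nlinarith [mul_nonneg hL hx0]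
          gcongr
        · refine le_add_of_le_of_nonneg ?_ (by positivity)
          have : L * (1 - x) / 2 ≤ L * (x * (1 - x)) := by nlinarith [mul_nonneg hL hx1]
          gcongr
    _ = _ := intervalIntegral.integral_eq_sub_of_hasDerivAt h1 hc1.intervalIntegrable
    _ ≤ _ := by
        have : 0 ≤ L / (1 + L / 2) := by positivity
        simp only [sub_self, sub_zero, mul_zero, zero_div, add_zero, mul_one, div_one]
        rw [mul_div_assoc]
        linarith

open Finset in
theorem sum_inv_sq_le_of_le_abs (L : ℕ) (hL : 1 ≤ L) (A : Finset ℤ) (hA : ∀ n ∈ A, (L : ℤ) ≤ |n|) :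
    ∑ n ∈ A, (((n : ℝ)) ^ 2)⁻¹ ≤ 4 / L := by
  have key : ∀ B ⊆ A, Set.InjOn Int.natAbs (B : Set ℤ) → ∑ n ∈ B, (((n : ℝ)) ^ 2)⁻¹ ≤ 2 / L := by
    intro B hB hinj
    have h1 : ∑ n ∈ B, (((n : ℝ)) ^ 2)⁻¹ = ∑ i ∈ B.image Int.natAbs, (((i : ℝ)) ^ 2)⁻¹ := by
      rw [sum_image hinj]
      refine sum_congr rfl fun n _ => ?_
      rw [Nat.cast_natAbs, Int.cast_abs, sq_abs]
    obtain ⟨R, hR⟩ := (B.image Int.natAbs).exists_nat_subset_range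
    have h2 : B.image Int.natAbs ⊆ Ioo (L - 1) R := by
      intro i hi
      have hi' := mem_range.1 (hR hi)
      obtain ⟨n, hn, rfl⟩ := mem_image.1 hi
      have := hA n (hB hn)
      rw [Int.abs_eq_natAbs] at this
      rw [mem_Ioo]
      omega
    rw [h1]
    refine (sum_le_sum_of_subset_of_nonneg h2 fun _ _ _ => by positivity).trans ?_
    refine (sum_Ioo_inv_sq_le (α := ℝ) (L - 1) R).trans (le_of_eq ?_)
    push_cast [hL]; ring
  rw [← sum_filter_add_sum_filter_not A fun n => 0 ≤ n]
  have h1 := key (A.filter fun n => 0 ≤ n) (filter_subset _ _) (by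
    intro x hx y hy h
    simp at hx hy
    omega)
  have h2 := key (A.filter fun n => ¬ 0 ≤ n) (filter_subset _ _) (by
    intro x hx y hy h
    simp at hx hy
    omega)
  calc _ ≤ (2 : ℝ) / L + 2 / L := add_le_add h1 h2
    _ = _ := by ring

/-- Tail bound for the Fourier coefficients of a function which vanishes at the endpoints and whose
derivative is controlled by the profile at scale `L`. -/
theorem sum_norm_fourierCoeffOn_le {H H' : ℝ → ℂ} {E D : ℝ} (L : ℕ) (hL : 1 ≤ L)
    (h0 : H 0 = 0) (h1 : H 1 = 0)
    (hHb : ∀ x ∈ Set.Ioo (0 : ℝ) 1, ‖H x‖ ≤ E * (x * (1 - x)))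
    (hd : ∀ x ∈ Set.Ioo (0 : ℝ) 1, HasDerivAt H (H' x) x)
    (hc : ContinuousOn H' (Set.Ioo 0 1))
    (hD : ∀ x ∈ Set.Ioo (0 : ℝ) 1, ‖H' x‖ ≤ D * (L / (1 + L * (x * (1 - x)))))
    (A : Finset ℤ) (hA : ∀ n ∈ A, (L : ℤ) ≤ |n|) :
    ∑ n ∈ A, ‖fourierCoeffOn zero_lt_one H n‖ ≤ 2 + 2 * D ^ 2 := by
  have hLpos : (0 : ℝ) < L := by exact_mod_cast hL
  have hD0 : 0 ≤ D := by
    have := (norm_nonneg _).trans (hD (1 / 2) (by norm_num))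
    refine nonneg_of_mul_nonneg_left this ?_
    have : (0 : ℝ) ≤ L * (1 / 2 * (1 - 1 / 2)) := by positivity
    positivity
  have hIcc : ∀ x ∈ Set.Icc (0 : ℝ) 1, ‖H x‖ ≤ E * (x * (1 - x)) := by
    intro x hx
    rcases hx.1.eq_or_lt with rfl | h
    · simp [h0]
    rcases hx.2.eq_or_lt with rfl | h'
    · simp [h1]
    exact hHb x ⟨h, h'⟩
  have hend : ∀ x ∈ Set.Icc (0 : ℝ) 1, x * (1 - x) = 0 → H x = 0 →
      ContinuousWithinAt H (Set.Icc 0 1) x := by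
    intro x hx hx0 hHx
    rw [ContinuousWithinAt, hHx]
    refine squeeze_zero_norm' (a := fun x => E * (x * (1 - x))) ?_ ?_
    · filter_upwards [self_mem_nhdsWithin] with y hy using hIcc y hy
    · have : ContinuousWithinAt (fun x => E * (x * (1 - x))) (Set.Icc 0 1) x := by fun_prop
      rw [ContinuousWithinAt, hx0, mul_zero] at this
      exact this
  have hcont : ContinuousOn H (Set.uIcc 0 1) := by
    rw [Set.uIcc_of_le zero_le_one]
    intro x hx
    rcases hx.1.eq_or_lt with rfl | h
    · exact hend 0 hx (by simp) h0
    rcases hx.2.eq_or_lt with rfl | h'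
    · exact hend 1 hx (by simp) h1
    exact (hd x ⟨h, h'⟩).continuousAt.continuousWithinAt
  have hmem : ∀ᵐ x ∂volume.restrict (Set.Ioc (0 : ℝ) 1), x ∈ Set.Ioo (0 : ℝ) 1 := by
    rw [← restrict_Ioo_eq_restrict_Ioc]
    exact ae_restrict_mem measurableSet_Ioo
  have hmeas : AEStronglyMeasurable H' (volume.restrict (Set.Ioc 0 1)) := by
    rw [← restrict_Ioo_eq_restrict_Ioc]
    exact hc.aestronglyMeasurable measurableSet_Ioo
  have hbd : ∀ᵐ x ∂volume.restrict (Set.Ioc (0 : ℝ) 1), ‖H' x‖ ≤ D * L := by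
    filter_upwards [hmem] with x hx
    refine (hD x hx).trans (mul_le_mul_of_nonneg_left (div_le_self hLpos.le ?_) hD0)
    have hx0 := hx.1
    have hx1 : 0 < 1 - x := by linarith [hx.2]
    have : (0 : ℝ) ≤ L * (x * (1 - x)) := by positivity
    linarith
  have hL2 : MemLp H' 2 (volume.restrict (Set.Ioc 0 1)) := MemLp.of_bound hmeas _ hbd
  have hint : IntervalIntegrable H' volume 0 1 := by
    rw [intervalIntegrable_iff_integrableOn_Ioc_of_le zero_le_one]
    exact Integrable.of_bound hmeas _ hbd
  have hsq : ∑ n ∈ A, ‖fourierCoeffOn zero_lt_one H' n‖ ^ 2 ≤ D ^ 2 * (4 * L) := by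
    calc _ ≤ ∫ x in (0 : ℝ)..1, ‖H' x‖ ^ 2 := by
          simpa using sum_le_hasSum A (fun _ _ => by positivity)
            (hasSum_sq_fourierCoeffOn zero_lt_one hL2)
      _ ≤ ∫ x in (0 : ℝ)..1, D ^ 2 * (L / (1 + L * (x * (1 - x)))) ^ 2 := by
          have hcc : ContinuousOn (fun x : ℝ => D ^ 2 * (L / (1 + L * (x * (1 - x)))) ^ 2)
              (Set.Icc 0 1) := by
            refine continuousOn_const.mul ((continuousOn_const.div (by fun_prop)
              fun x hx => ?_).pow 2)
            have hx1 : 0 ≤ 1 - x := by linarith [hx.2]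
            have hx0 := hx.1
            positivity
          rw [intervalIntegral.integral_of_le zero_le_one,
            intervalIntegral.integral_of_le zero_le_one]
          refine integral_mono_ae hL2.norm.integrable_sq
            (hcc.integrableOn_Icc.mono_set Set.Ioc_subset_Icc_self) ?_
          filter_upwards [hmem] with x hx
          rw [← mul_pow]
          exact pow_le_pow_left₀ (norm_nonneg _) (hD x hx) 2
      _ ≤ _ := by
          rw [intervalIntegral.integral_const_mul]
          exact mul_le_mul_of_nonneg_left (integral_sq_profile_le L hLpos.le) (by positivity)
  have hcoeff : ∀ n ∈ A, ‖fourierCoeffOn zero_lt_one H n‖ ≤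
      (L * ((n : ℝ) ^ 2)⁻¹ + (L : ℝ)⁻¹ * ‖fourierCoeffOn zero_lt_one H' n‖ ^ 2) / 2 := by
    intro n hn
    have hn0 : n ≠ 0 := by
      rintro rfl
      have := hA 0 hn
      rw [abs_zero] at this
      omega
    have hn1 : (0 : ℝ) < |(n : ℝ)| := by
      rw [abs_pos]; exact_mod_cast hn0
    rw [fourierCoeffOn_of_hasDeriv_right zero_lt_one hn0 hcont
      (fun x hx => (hd x (by simpa using hx)).hasDerivWithinAt) hint, h0, h1]
    set z := fourierCoeffOn zero_lt_one H' n
    have e1 : ‖(1 / (-2 * π * I * n) : ℂ)‖ ≤ |(n : ℝ)|⁻¹ := by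
      rw [norm_div, norm_one, one_div]
      refine inv_anti₀ hn1 ?_
      simp only [norm_mul, norm_neg, Complex.norm_I, Complex.norm_real, Complex.norm_intCast,
        Complex.norm_ofNat, mul_one, Real.norm_eq_abs, abs_of_pos Real.pi_pos]
      nlinarith [Real.pi_gt_three]
    have e2 : ‖(1 / (-2 * π * I * n) : ℂ) * (fourier (-n) ((0 : ℝ) : AddCircle (1 - 0 : ℝ)) * (0 - 0)
        - ((1 : ℝ) - (0 : ℝ)) * z)‖ ≤ |(n : ℝ)|⁻¹ * ‖z‖ := by
      rw [norm_mul]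
      refine mul_le_mul e1 (le_of_eq ?_) (norm_nonneg _) (by positivity)
      simp
    refine e2.trans ?_
    have e3 : ((n : ℝ) ^ 2)⁻¹ = (|(n : ℝ)|⁻¹) ^ 2 := by rw [inv_pow, sq_abs]
    rw [e3]
    set a := |(n : ℝ)|⁻¹
    have e4 : (L * a ^ 2 + (L : ℝ)⁻¹ * ‖z‖ ^ 2) / 2 - a * ‖z‖ =
        (L : ℝ)⁻¹ * (L * a - ‖z‖) ^ 2 / 2 := by
      field_simp; ring
    have : 0 ≤ (L : ℝ)⁻¹ * (L * a - ‖z‖) ^ 2 / 2 := by positivity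
    linarith
  refine (Finset.sum_le_sum hcoeff).trans ?_
  rw [← Finset.sum_div, Finset.sum_add_distrib, ← Finset.mul_sum, ← Finset.mul_sum]
  have f1 := mul_le_mul_of_nonneg_left (sum_inv_sq_le_of_le_abs L hL A hA) hLpos.le
  have f2 := mul_le_mul_of_nonneg_left hsq (inv_nonneg.2 hLpos.le)
  have f3 : (L : ℝ) * (4 / L) = 4 := by field_simp
  have f4 : (L : ℝ)⁻¹ * (D ^ 2 * (4 * L)) = 4 * D ^ 2 := by field_simp
  linarith

theorem norm_exp_two_pi_I_mul_sub_one_le (h : ℤ) {x : ℝ} (hx : x ∈ Set.Ioo (0 : ℝ) 1) :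
    ‖Complex.exp (2 * π * I * h * x) - 1‖ ≤ 4 * π * |(h : ℝ)| * (x * (1 - x)) := by
  have hx0 := hx.1
  have hx1 : 0 < 1 - x := by linarith [hx.2]
  have hmain : ∀ y : ℝ, ‖Complex.exp (2 * π * I * h * y) - 1‖ ≤ 2 * π * |(h : ℝ)| * |y| := by
    intro y
    rw [show (2 * π * I * h * y : ℂ) = I * ((2 * π * h * y : ℝ) : ℂ) by push_cast; ring]
    refine Real.norm_exp_I_mul_ofReal_sub_one_le.trans (le_of_eq ?_)
    rw [Real.norm_eq_abs, abs_mul, abs_mul, abs_mul, abs_of_pos Real.pi_pos, abs_two]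
  have hper : Complex.exp (2 * π * I * h * x) = Complex.exp (2 * π * I * h * (x - 1 : ℝ)) := by
    rw [Complex.exp_eq_exp_iff_exists_int]
    exact ⟨h, by push_cast; ring⟩
  have hK : 0 ≤ 2 * π * |(h : ℝ)| := by positivity
  rw [show 4 * π * |(h : ℝ)| * (x * (1 - x)) = 2 * π * |(h : ℝ)| * (2 * (x * (1 - x))) by ring]
  rcases le_total x (1 / 2) with hle | hle
  · refine (hmain x).trans (mul_le_mul_of_nonneg_left ?_ hK)
    rw [abs_of_pos hx0]
    nlinarith
  · rw [hper]
    refine (hmain (x - 1)).trans (mul_le_mul_of_nonneg_left ?_ hK)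
    rw [abs_of_neg (by linarith)]
    nlinarith

/-- The Hörmander regularity condition for the Fourier coefficients of a symbol satisfying a
first-order Mikhlin condition. -/
theorem sum_norm_fourierCoeffOn_sub_le {m m' : ℝ → ℂ} {M c : ℝ}
    (hM : ∀ x ∈ Set.Ioo (0 : ℝ) 1, ‖m x‖ ≤ M)
    (hd : ∀ x ∈ Set.Ioo (0 : ℝ) 1, HasDerivAt m (m' x) x)
    (hcont : ContinuousOn m' (Set.Ioo 0 1))
    (hc : ∀ x ∈ Set.Ioo (0 : ℝ) 1, x * (1 - x) * ‖m' x‖ ≤ c)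
    (L : ℕ) (hL : 1 ≤ L) (h : ℤ) (A : Finset ℤ) (hh : |h| ≤ L) (hA : ∀ n ∈ A, 2 * (L : ℤ) ≤ |n|) :
    ∑ n ∈ A, ‖fourierCoeffOn zero_lt_one m (n - h) - fourierCoeffOn zero_lt_one m n‖ ≤
      2 * (2 + 2 * (c + M) ^ 2) + (2 + 2 * (4 * π * c + 2 * M + 2 * π * M) ^ 2) := by
  have hLpos : (0 : ℝ) < L := by exact_mod_cast hL
  have hhL : |(h : ℝ)| ≤ L := by exact_mod_cast hh
  have hM0 : 0 ≤ M := (norm_nonneg _).trans (hM (1 / 2) (by norm_num))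
  have hmc : ContinuousOn m (Set.Ioo 0 1) := fun x hx => (hd x hx).continuousAt.continuousWithinAt
  have hw : ∀ x ∈ Set.Ioo (0 : ℝ) 1, 0 < x * (1 - x) := fun x hx =>
    mul_pos hx.1 (by linarith [hx.2])
  let q : ℝ → ℝ := fun x => 1 + L * (x * (1 - x))
  have hqcont : Continuous q := by fun_prop
  have hq1 : ∀ x ∈ Set.Ioo (0 : ℝ) 1, 1 ≤ q x := fun x hx =>
    le_add_of_nonneg_right (mul_pos hLpos (hw x hx)).le
  have hq0 : ∀ x ∈ Set.Ioo (0 : ℝ) 1, 0 < q x := fun x hx => one_pos.trans_le (hq1 x hx)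
  have hqd : ∀ x, HasDerivAt q (L * (1 - 2 * x)) x := by
    intro x
    exact ((((hasDerivAt_id' x).mul ((hasDerivAt_id' x).const_sub 1)).const_mul (L : ℝ)).const_add
      1).congr_deriv (by ring)
  let φ : ℝ → ℝ := fun x => (q x)⁻¹
  let φ' : ℝ → ℝ := fun x => -(L * (1 - 2 * x)) / q x ^ 2
  have hφd : ∀ x ∈ Set.Ioo (0 : ℝ) 1, HasDerivAt φ (φ' x) x := fun x hx =>
    (hqd x).inv (hq0 x hx).ne'
  have hφc : ContinuousOn φ (Set.Ioo 0 1) := hqcont.continuousOn.inv₀ fun x hx => (hq0 x hx).ne'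
  have hφ'c : ContinuousOn φ' (Set.Ioo 0 1) :=
    ContinuousOn.div (by fun_prop) (by fun_prop) fun x hx => (pow_pos (hq0 x hx) 2).ne'
  have hφ0 : ∀ x ∈ Set.Ioo (0 : ℝ) 1, 0 < φ x := fun x hx => inv_pos.2 (hq0 x hx)
  have hφ1 : ∀ x ∈ Set.Ioo (0 : ℝ) 1, φ x ≤ 1 := fun x hx => inv_le_one_of_one_le₀ (hq1 x hx)
  have hφ' : ∀ x ∈ Set.Ioo (0 : ℝ) 1, |φ' x| ≤ L * φ x := by
    intro x hx
    rw [abs_div, abs_neg, abs_mul, abs_of_pos hLpos, abs_of_pos (pow_pos (hq0 x hx) 2),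
      div_eq_mul_inv, mul_assoc]
    refine mul_le_mul_of_nonneg_left ?_ hLpos.le
    have h1 : |1 - 2 * x| ≤ 1 := abs_le.2 ⟨by linarith [hx.2], by linarith [hx.1]⟩
    have h2 : (q x ^ 2)⁻¹ ≤ φ x := inv_anti₀ (hq0 x hx) (by nlinarith [hq1 x hx])
    calc |1 - 2 * x| * (q x ^ 2)⁻¹ ≤ 1 * φ x :=
          mul_le_mul h1 h2 (by positivity) zero_le_one
      _ = φ x := one_mul _
  let e : ℝ → ℂ := fun x => Complex.exp (2 * π * I * h * x)
  have he : Continuous e := by fun_prop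
  have hed : ∀ x, HasDerivAt e (e x * (2 * π * I * h)) x := by
    intro x
    have h1 : HasDerivAt (fun y : ℝ => (2 * π * I * h : ℂ) * (y : ℂ)) (2 * π * I * h) x := by
      simpa using (hasDerivAt_id' x).ofReal_comp.const_mul (2 * π * I * h : ℂ)
    exact h1.cexp
  have he1 : ∀ x, ‖e x‖ = 1 := norm_exp_two_pi_I_mul h
  have he2 : ∀ x, ‖e x - 1‖ ≤ 2 := fun x =>
    (norm_sub_le _ _).trans (by rw [he1, norm_one]; norm_num)
  have he3 : ∀ x ∈ Set.Ioo (0 : ℝ) 1, ‖e x - 1‖ ≤ 4 * π * L * (x * (1 - x)) := by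
    intro x hx
    refine (norm_exp_two_pi_I_mul_sub_one_le h hx).trans ?_
    have := (hw x hx).le
    gcongr
  let H₁ : ℝ → ℂ := fun x => m x * ((1 - φ x : ℝ) : ℂ)
  let H₂ : ℝ → ℂ := fun x => m x * (φ x : ℂ) * (e x - 1)
  have hψ : ∀ x ∈ Set.Ioo (0 : ℝ) 1, 1 - φ x = φ x * (L * (x * (1 - x))) := by
    intro x hx
    have : φ x * q x = 1 := inv_mul_cancel₀ (hq0 x hx).ne'
    simp only [q] at this
    linarith
  have hb₁ : ∀ A : Finset ℤ, (∀ n ∈ A, (L : ℤ) ≤ |n|) →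
      ∑ n ∈ A, ‖fourierCoeffOn zero_lt_one H₁ n‖ ≤ 2 + 2 * (c + M) ^ 2 := by
    refine sum_norm_fourierCoeffOn_le (E := M * L)
      (H' := fun x => m' x * ((1 - φ x : ℝ) : ℂ) + m x * ((-φ' x : ℝ) : ℂ)) L hL
      (by simp [H₁, φ, q]) (by simp [H₁, φ, q]) ?_ ?_ ?_ ?_
    · intro x hx
      have hp := hφ0 x hx
      have hwx := hw x hx
      rw [norm_mul, Complex.norm_real, hψ x hx, Real.norm_of_nonneg (by positivity), mul_assoc]
      refine mul_le_mul (hM x hx) (mul_le_of_le_one_left (by positivity) (hφ1 x hx))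
        (by positivity) hM0
    · intro x hx
      exact (hd x hx).mul ((hφd x hx).const_sub 1).ofReal_comp
    · exact (hcont.mul (Complex.continuous_ofReal.comp_continuousOn (continuousOn_const.sub hφc))).add
        (hmc.mul (Complex.continuous_ofReal.comp_continuousOn hφ'c.neg))
    · intro x hx
      have hp := hφ0 x hx
      have hwx := hw x hx
      have t1 : ‖m' x * ((1 - φ x : ℝ) : ℂ)‖ ≤ c * (L * φ x) := by
        rw [norm_mul, Complex.norm_real, hψ x hx, Real.norm_of_nonneg (by positivity)]
        calc _ = (x * (1 - x) * ‖m' x‖) * (L * φ x) := by ring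
          _ ≤ _ := mul_le_mul_of_nonneg_right (hc x hx) (by positivity)
      have t2 : ‖m x * ((-φ' x : ℝ) : ℂ)‖ ≤ M * (L * φ x) := by
        rw [norm_mul, Complex.norm_real, norm_neg, Real.norm_eq_abs]
        exact mul_le_mul (hM x hx) (hφ' x hx) (abs_nonneg _) hM0
      calc _ ≤ c * (L * φ x) + M * (L * φ x) := (norm_add_le _ _).trans (add_le_add t1 t2)
        _ = _ := by simp only [φ, q, div_eq_mul_inv]; ring
  have hb₂ : ∀ A : Finset ℤ, (∀ n ∈ A, (L : ℤ) ≤ |n|) →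
      ∑ n ∈ A, ‖fourierCoeffOn zero_lt_one H₂ n‖ ≤
        2 + 2 * (4 * π * c + 2 * M + 2 * π * M) ^ 2 := by
    refine sum_norm_fourierCoeffOn_le (E := M * (4 * π * L))
      (H' := fun x => (m' x * (φ x : ℂ) + m x * (φ' x : ℂ)) * (e x - 1) +
        m x * (φ x : ℂ) * (e x * (2 * π * I * h))) L hL (by simp [H₂, e]) ?_ ?_ ?_ ?_ ?_
    · have : e 1 = 1 := by
        simp only [e]
        rw [Complex.exp_eq_one_iff]
        exact ⟨h, by push_cast; ring⟩
      simp [H₂, this]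
    · intro x hx
      have hp := hφ0 x hx
      rw [norm_mul, norm_mul, Complex.norm_real, Real.norm_of_nonneg hp.le, mul_assoc M]
      refine mul_le_mul ?_ (he3 x hx) (norm_nonneg _) hM0
      exact (mul_le_of_le_one_right (norm_nonneg _) (hφ1 x hx)).trans (hM x hx)
    · intro x hx
      exact ((hd x hx).mul (hφd x hx).ofReal_comp).mul ((hed x).sub_const 1)
    · have hφc' : ContinuousOn (fun x => (φ x : ℂ)) (Set.Ioo 0 1) :=
        Complex.continuous_ofReal.comp_continuousOn hφc
      have hφ'c' : ContinuousOn (fun x => (φ' x : ℂ)) (Set.Ioo 0 1) :=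
        Complex.continuous_ofReal.comp_continuousOn hφ'c
      exact (((hcont.mul hφc').add (hmc.mul hφ'c')).mul (by fun_prop)).add
        ((hmc.mul hφc').mul (by fun_prop))
    · intro x hx
      have hp := hφ0 x hx
      have hwx := hw x hx
      have t1 : ‖m' x * (φ x : ℂ) * (e x - 1)‖ ≤ 4 * π * c * (L * φ x) := by
        rw [norm_mul, norm_mul, Complex.norm_real, Real.norm_of_nonneg hp.le]
        calc _ ≤ ‖m' x‖ * φ x * (4 * π * L * (x * (1 - x))) :=
              mul_le_mul_of_nonneg_left (he3 x hx) (by positivity)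
          _ = (x * (1 - x) * ‖m' x‖) * (4 * π * L * φ x) := by ring
          _ ≤ c * (4 * π * L * φ x) := mul_le_mul_of_nonneg_right (hc x hx) (by positivity)
          _ = _ := by ring
      have t2 : ‖m x * (φ' x : ℂ) * (e x - 1)‖ ≤ 2 * M * (L * φ x) := by
        rw [norm_mul, norm_mul, Complex.norm_real, Real.norm_eq_abs]
        calc _ ≤ M * (L * φ x) * 2 :=
              mul_le_mul (mul_le_mul (hM x hx) (hφ' x hx) (abs_nonneg _) hM0) (he2 x)
                (norm_nonneg _) (by positivity)
          _ = _ := by ring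
      have t3 : ‖m x * (φ x : ℂ) * (e x * (2 * π * I * h))‖ ≤ 2 * π * M * (L * φ x) := by
        have : ‖(2 * π * I * h : ℂ)‖ = 2 * π * |(h : ℝ)| := by
          simp [abs_of_pos Real.pi_pos]
        rw [norm_mul, norm_mul, norm_mul, Complex.norm_real, Real.norm_of_nonneg hp.le, he1, this]
        calc _ ≤ M * φ x * (1 * (2 * π * L)) := by
              have := hM x hx
              gcongr
          _ = _ := by ring
      calc _ ≤ 4 * π * c * (L * φ x) + 2 * M * (L * φ x) + 2 * π * M * (L * φ x) := by
            rw [add_mul]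
            exact (norm_add_le _ _).trans
              (add_le_add ((norm_add_le _ _).trans (add_le_add t1 t2)) t3)
        _ = _ := by simp only [φ, q, div_eq_mul_inv]; ring
  have hInt : ∀ {H : ℝ → ℂ} (R : ℝ), ContinuousOn H (Set.Ioo 0 1) →
      (∀ x ∈ Set.Ioo (0 : ℝ) 1, ‖H x‖ ≤ R) → IntervalIntegrable H volume 0 1 := by
    intro H R h1 h2
    rw [intervalIntegrable_iff_integrableOn_Ioo_of_le zero_le_one]
    refine Integrable.of_bound (h1.aestronglyMeasurable measurableSet_Ioo) R ?_
    filter_upwards [ae_restrict_mem measurableSet_Ioo] with x hx using h2 x hx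
  have hφc' : ContinuousOn (fun x => (φ x : ℂ)) (Set.Ioo 0 1) :=
    Complex.continuous_ofReal.comp_continuousOn hφc
  have hmφ : IntervalIntegrable (fun x => m x * (φ x : ℂ)) volume 0 1 := by
    refine hInt M (hmc.mul hφc') fun x hx => ?_
    rw [norm_mul, Complex.norm_real, Real.norm_of_nonneg (hφ0 x hx).le]
    exact (mul_le_of_le_one_right (norm_nonneg _) (hφ1 x hx)).trans (hM x hx)
  have hmI := hInt M hmc hM
  have hI₁ : IntervalIntegrable H₁ volume 0 1 := by
    rw [show H₁ = fun x => m x - m x * (φ x : ℂ) by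
      funext x; simp only [H₁]; push_cast; ring]
    exact hmI.sub hmφ
  have hI₂ : IntervalIntegrable H₂ volume 0 1 :=
    hmφ.mul_continuousOn (by fun_prop)
  have hsplit : ∀ n, fourierCoeffOn zero_lt_one m (n - h) - fourierCoeffOn zero_lt_one m n =
      fourierCoeffOn zero_lt_one H₁ (n - h) - fourierCoeffOn zero_lt_one H₁ n +
        fourierCoeffOn zero_lt_one H₂ n := by
    intro n
    simp only [fourierCoeffOn_zero_one]
    rw [← intervalIntegral.integral_sub (hmI.continuousOn_mul (by fun_prop))
        (hmI.continuousOn_mul (by fun_prop)),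
      ← intervalIntegral.integral_sub (hI₁.continuousOn_mul (by fun_prop))
        (hI₁.continuousOn_mul (by fun_prop)),
      ← intervalIntegral.integral_add ((hI₁.continuousOn_mul (by fun_prop)).sub
        (hI₁.continuousOn_mul (by fun_prop))) (hI₂.continuousOn_mul (by fun_prop))]
    refine intervalIntegral.integral_congr fun x _ => ?_
    have : Complex.exp (2 * π * I * (-(n - h) : ℤ) * x) =
        Complex.exp (2 * π * I * (-n : ℤ) * x) * e x := by
      simp only [e]
      rw [← Complex.exp_add]; congr 1; push_cast; ring
    simp only [this, H₁, H₂]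
    push_cast
    ring
  have hA' : ∀ n ∈ A.map (Equiv.subRight h).toEmbedding, (L : ℤ) ≤ |n| := by
    intro n hn
    obtain ⟨k, hk, rfl⟩ := Finset.mem_map.1 hn
    have h1 := hA k hk
    have h2 := abs_sub_abs_le_abs_sub k h
    simp only [Equiv.toEmbedding_apply, Equiv.subRight_apply]
    omega
  have s1 := hb₁ _ hA'
  rw [Finset.sum_map] at s1
  have s2 := hb₁ A fun n hn => by have := hA n hn; omega
  have s3 := hb₂ A fun n hn => by have := hA n hn; omega
  calc _ ≤ ∑ n ∈ A, (‖fourierCoeffOn zero_lt_one H₁ (n - h)‖ + ‖fourierCoeffOn zero_lt_one H₁ n‖ +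
        ‖fourierCoeffOn zero_lt_one H₂ n‖) := by
        refine Finset.sum_le_sum fun n _ => ?_
        rw [hsplit]
        exact (norm_add_le _ _).trans (add_le_add_left (norm_sub_le _ _) _)
    _ ≤ _ := by
        rw [Finset.sum_add_distrib, Finset.sum_add_distrib]
        simp only [Equiv.toEmbedding_apply, Equiv.subRight_apply] at s1
        linarith

/-- A symbol satisfying a first-order Mikhlin condition at `0` and `1` has a Calderón–Zygmund
kernel. -/
theorem isCZKernel_fourierCoeffOn {m m' : ℝ → ℂ} {M c : ℝ}
    (hM : ∀ x ∈ Set.Ioo (0 : ℝ) 1, ‖m x‖ ≤ M)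
    (hd : ∀ x ∈ Set.Ioo (0 : ℝ) 1, HasDerivAt m (m' x) x)
    (hcont : ContinuousOn m' (Set.Ioo 0 1))
    (hc : ∀ x ∈ Set.Ioo (0 : ℝ) 1, x * (1 - x) * ‖m' x‖ ≤ c) :
    IsCZKernel (fourierCoeffOn zero_lt_one m) (M ^ 2)
      (2 * (2 + 2 * (c + M) ^ 2) + (2 + 2 * (4 * π * c + 2 * M + 2 * π * M) ^ 2)) where
  nonneg := sq_nonneg M
  nonneg' := by positivity
  sq_le S A f := by
    refine sum_sq_fourierCoeffOn_conv_le ?_ ?_ S A f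
    · rw [← restrict_Ioo_eq_restrict_Ioc]
      exact ContinuousOn.aestronglyMeasurable
        (fun x hx => (hd x hx).continuousAt.continuousWithinAt) measurableSet_Ioo
    · rw [← restrict_Ioo_eq_restrict_Ioc]
      filter_upwards [ae_restrict_mem measurableSet_Ioo] with x hx using hM x hx
  sub_le L h A hh hA := by
    rcases Nat.eq_zero_or_pos L with rfl | hL
    · obtain rfl : h = 0 := by simpa using hh
      simp only [sub_zero, sub_self, norm_zero, Finset.sum_const_zero]
      positivity
    · exact sum_norm_fourierCoeffOn_sub_le hM hd hcont hc L hL h A hh hA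

theorem hasSum_fourierCoeffOn_mul_TmultZ {m : ℝ → ℂ} {M : ℝ}
    (hm : ContinuousOn m (Set.Ioo 0 1)) (hM : ∀ x ∈ Set.Ioo (0 : ℝ) 1, ‖m x‖ ≤ M)
    {f : ℤ → ℂ} (hf : Summable fun n => ‖f n‖) (n : ℤ) :
    HasSum (fun k => fourierCoeffOn zero_lt_one m (n - k) * f k) (TmultZ m f n) := by
  let F : ℤ → ℝ → ℂ := fun k ξ => m ξ * (f k * Complex.exp (2 * π * I * k * ξ)) *
    Complex.exp (-(2 * π * I) * ξ * n)
  have hn1 : ∀ ξ : ℝ, ‖Complex.exp (-(2 * π * I) * ξ * n)‖ = 1 := by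
    intro ξ
    rw [show (-(2 * π * I) * ξ * n : ℂ) = 2 * π * I * (-n : ℤ) * ξ by push_cast; ring,
      norm_exp_two_pi_I_mul]
  have hFn : ∀ k, ∀ ξ, ‖F k ξ‖ = ‖m ξ‖ * ‖f k‖ := by
    intro k ξ
    simp only [F, norm_mul, hn1, norm_exp_two_pi_I_mul, mul_one]
  have hmI : Integrable m (volume.restrict (Set.Ioo 0 1)) := by
    refine Integrable.of_bound (hm.aestronglyMeasurable measurableSet_Ioo) M ?_
    filter_upwards [ae_restrict_mem measurableSet_Ioo] with x hx using hM x hx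
  have hFint : ∀ k, Integrable (F k) (volume.restrict (Set.Ioo 0 1)) := by
    intro k
    refine Integrable.mono' (hmI.norm.mul_const ‖f k‖) ?_
      (Filter.Eventually.of_forall fun ξ => (hFn k ξ).le)
    exact (hmI.aestronglyMeasurable.mul (by fun_prop)).mul (by fun_prop)
  have hsum := hasSum_integral_of_summable_integral_norm hFint (by
    simp only [hFn, integral_mul_const]
    exact hf.mul_left _)
  have h1 : ∫ ξ in Set.Ioo (0 : ℝ) 1, ∑' k, F k ξ = TmultZ m f n := by
    unfold TmultZ dftZ
    simp only [F, tsum_mul_right, tsum_mul_left]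
  have h2 : ∀ k, ∫ ξ in Set.Ioo (0 : ℝ) 1, F k ξ = fourierCoeffOn zero_lt_one m (n - k) * f k := by
    intro k
    rw [fourierCoeffOn_zero_one, intervalIntegral.integral_of_le zero_le_one,
      integral_Ioc_eq_integral_Ioo, ← integral_mul_const]
    congr 1
    funext ξ
    have : Complex.exp (2 * π * I * (-(n - k) : ℤ) * ξ) =
        Complex.exp (2 * π * I * k * ξ) * Complex.exp (-(2 * π * I) * ξ * n) := by
      rw [← Complex.exp_add]; congr 1; push_cast; ring
    simp only [F, this]
    ring
  rw [h1] at hsum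
  simpa only [h2] using hsum

theorem lpNormZ_eq_tsum {p : ℝ} (hp : 0 < p) (f : ℤ → ℂ) :
    lpNormZ f p = (∑' n, ‖f n‖ₑ ^ p) ^ (1 / p) := by
  rw [lpNormZ, eLpNorm_eq_lintegral_rpow_enorm_toReal (by simpa using hp) ENNReal.ofReal_ne_top,
    ENNReal.toReal_ofReal hp.le, lintegral_count]

/-- Passage from finite truncations to all of `ℓ¹(ℤ)`. -/
theorem lpNormZ_le_of_forall_finset {K : ℤ → ℂ} {p C : ℝ} (hp : 0 < p) (hC : 0 ≤ C)
    (hK : ∀ (S A : Finset ℤ) (f : ℤ → ℂ),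
      ∑ n ∈ A, ‖∑ k ∈ S, K (n - k) * f k‖ ^ p ≤ C * ∑ n ∈ S, ‖f n‖ ^ p)
    {f g : ℤ → ℂ} (hg : ∀ n, HasSum (fun k => K (n - k) * f k) (g n)) :
    lpNormZ g p ≤ ENNReal.ofReal (C ^ (1 / p)) * lpNormZ f p := by
  have henorm : ∀ z : ℂ, ‖z‖ₑ ^ p = ENNReal.ofReal (‖z‖ ^ p) := by
    intro z
    rw [← ofReal_norm, ENNReal.ofReal_rpow_of_nonneg (norm_nonneg z) hp.le]
  rw [lpNormZ_eq_tsum hp, lpNormZ_eq_tsum hp, ← ENNReal.ofReal_rpow_of_nonneg hC (by positivity),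
    ← ENNReal.mul_rpow_of_nonneg _ _ (by positivity)]
  refine ENNReal.rpow_le_rpow ?_ (by positivity)
  rw [ENNReal.tsum_eq_iSup_sum]
  refine iSup_le fun A => ?_
  have htend : Filter.Tendsto (fun S : Finset ℤ => ∑ n ∈ A, ‖∑ k ∈ S, K (n - k) * f k‖ₑ ^ p)
      Filter.atTop (nhds (∑ n ∈ A, ‖g n‖ₑ ^ p)) :=
    tendsto_finsetSum _ fun n _ =>
      ((ENNReal.continuous_rpow_const.comp continuous_enorm).tendsto _).comp (hg n)
  refine le_of_tendsto' htend fun S => ?_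
  calc ∑ n ∈ A, ‖∑ k ∈ S, K (n - k) * f k‖ₑ ^ p
      = ENNReal.ofReal (∑ n ∈ A, ‖∑ k ∈ S, K (n - k) * f k‖ ^ p) := by
        rw [ENNReal.ofReal_sum_of_nonneg fun _ _ => by positivity]
        simp only [henorm]
    _ ≤ ENNReal.ofReal (C * ∑ n ∈ S, ‖f n‖ ^ p) := ENNReal.ofReal_le_ofReal (hK S A f)
    _ = ENNReal.ofReal C * ∑ n ∈ S, ‖f n‖ₑ ^ p := by
        rw [ENNReal.ofReal_mul hC, ENNReal.ofReal_sum_of_nonneg fun _ _ => by positivity]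
        simp only [henorm]
    _ ≤ _ := by
        gcongr
        exact ENNReal.sum_le_tsum S

/-- If `m` is a bounded `C²` function on `(0,1)` with
`(ξ(1−ξ))^k |m^{(k)}(ξ)| ≤ c` for `k = 0,1,2`, then `T_m` is bounded on `ℓ^p(ℤ)` for
all `1 < p < ∞`. -/
theorem stmt_14 (m : ℝ → ℂ) (M : ℝ) (hbdd : ∀ ξ ∈ Set.Ioo (0 : ℝ) 1, ‖m ξ‖ ≤ M)
    (hsmooth : ContDiffOn ℝ 2 m (Set.Ioo (0 : ℝ) 1))
    (c : ℝ) (hc : 0 < c)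
    (hmik : ∀ k : ℕ, k ≤ 2 → ∀ ξ ∈ Set.Ioo (0 : ℝ) 1,
      (ξ * (1 - ξ)) ^ k * ‖iteratedDerivWithin k m (Set.Ioo (0 : ℝ) 1) ξ‖ ≤ c) :
    ∀ p : ℝ, 1 < p →
      ∃ C : ℝ, 0 < C ∧ ∀ f : ℤ → ℂ, Summable (fun n => ‖f n‖) →
        lpNormZ (TmultZ m f) p ≤ ENNReal.ofReal C * lpNormZ f p := by
  intro p hp
  have hp0 : 0 < p := one_pos.trans hp
  have hd : ∀ x ∈ Set.Ioo (0 : ℝ) 1, HasDerivAt m (deriv m x) x := fun x hx =>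
    ((hsmooth.differentiableOn two_ne_zero).differentiableAt
      (isOpen_Ioo.mem_nhds hx)).hasDerivAt
  have hcont : ContinuousOn (deriv m) (Set.Ioo 0 1) :=
    hsmooth.continuousOn_deriv_of_isOpen isOpen_Ioo one_le_two
  have hc1 : ∀ x ∈ Set.Ioo (0 : ℝ) 1, x * (1 - x) * ‖deriv m x‖ ≤ c := by
    intro x hx
    have h := hmik 1 one_le_two x hx
    rwa [pow_one, iteratedDerivWithin_one, derivWithin_of_isOpen isOpen_Ioo hx] at h
  have hK := isCZKernel_fourierCoeffOn hbdd hd hcont hc1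
  obtain ⟨C, hC, hstrong⟩ : ∃ C : ℝ, 0 ≤ C ∧ ∀ (S A : Finset ℤ) (f : ℤ → ℂ),
      ∑ n ∈ A, ‖∑ k ∈ S, fourierCoeffOn zero_lt_one m (n - k) * f k‖ ^ p ≤
        C * ∑ n ∈ S, ‖f n‖ ^ p := by
    rcases le_or_gt p 2 with h | h
    · exact hK.strong_type_of_le_two hp h
    · exact hK.strong_type_of_two_lt h
  refine ⟨(C + 1) ^ (1 / p), by positivity, fun f hf => ?_⟩
  refine lpNormZ_le_of_forall_finset hp0 (by positivity) (fun S A f => ?_)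
    (hasSum_fourierCoeffOn_mul_TmultZ hsmooth.continuousOn hbdd hf)
  refine (hstrong S A f).trans ?_
  gcongr
  linarith
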